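/- Let t ≥ 3, let b : Fin t → ℝ be strictly increasing, let ε, d : ℝ, define a k = ε * (b k) + d and R k l = (b k) * (b l) + (a k) + (a l). Assume: (i) R k (k+1) ≥ 0 for all k with k+1 < t; (ii) R 0 (t−1) ≤ 0; (iii) for every k, ∑_{m ≠ k} (R k m) / ((b k) − (b m)) = 0. Then b 0 + ε < 0 and b (t−1) + ε > 0. -/

import Mathlib

/-- If the numbers `x m` satisfy the Cartan identities with curvatures `x k * x m + c`, `i` and `j`
index the smallest and second smallest of them and `l ≠ i, j` the largest, and the curvature between
`i` and `l` is nonpositive, then `x i` is negative. -/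
theorem neg_of_cartan_of_extreme_nonpos {ι : Type*} [Fintype ι] [DecidableEq ι] {x : ι → ℝ} {c : ℝ}
    {i j l : ι} (hij : j ≠ i) (hli : l ≠ i) (hlj : l ≠ j)
    (hi : ∀ m, m ≠ i → x i < x m) (hj : ∀ m, m ≠ i → m ≠ j → x j < x m) (hl : ∀ m, x m ≤ x l)
    (hext : x i * x l + c ≤ 0)
    (hcartan : ∀ k, ∑ m ∈ Finset.univ.filter (fun m => m ≠ k), (x k * x m + c) / (x k - x m) = 0) :
    x i < 0 := by
  by_contra! hx
  have hterm : ∀ m ∈ Finset.univ.filter (fun m => m ≠ i),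
      0 ≤ (x i * x m + c) / (x i - x m) := by
    intro m hm
    have hlt := hi m (by simpa using hm)
    exact div_nonneg_of_nonpos (by linarith [mul_le_mul_of_nonneg_left (hl m) hx]) (by linarith)
  have hzero : ∀ m, m ≠ i → x i * x m + c = 0 := by
    intro m hm
    have h := (Finset.sum_eq_zero_iff_of_nonneg hterm).1 (hcartan i) m (by simpa using hm)
    exact (div_eq_zero_iff.1 h).resolve_right (by linarith [hi m hm])
  have hjl := hj l hli hlj
  have hxi : x i = 0 := by
    have h : x i * (x l - x j) = 0 := by linarith [hzero j hij, hzero l hli]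
    exact (mul_eq_zero.1 h).resolve_right (by linarith)
  have hc : c = 0 := by simpa [hxi] using hzero j hij
  have hxj : 0 < x j := hxi ▸ hi j hij
  refine (Finset.sum_neg' ?_ ⟨l, by simpa using hlj, ?_⟩).ne (hcartan j)
  · intro m hm
    rcases eq_or_ne m i with rfl | hmi
    · simp [hxi, hc]
    · have hlt := hj m hmi (by simpa using hm)
      have : 0 < x j * x m := mul_pos hxj (hxj.trans hlt)
      exact div_nonpos_of_nonneg_of_nonpos (by linarith) (by linarith)
  · have : 0 < x j * x l := mul_pos hxj (hxj.trans hjl)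
    exact div_neg_of_pos_of_neg (by linarith) (by linarith)

theorem stmt_6 (t : ℕ) (ht : 3 ≤ t) (b : Fin t → ℝ) (hb : StrictMono b)
    (ε d : ℝ) (a : Fin t → ℝ) (ha : ∀ k, a k = ε * b k + d)
    (R : Fin t → Fin t → ℝ) (hRdef : ∀ k l, R k l = b k * b l + a k + a l)
    (hconsec : ∀ k : ℕ, (h : k + 1 < t) →
      0 ≤ R ⟨k, Nat.lt_of_succ_lt h⟩ ⟨k + 1, h⟩)
    (hext : R ⟨0, by omega⟩ ⟨t - 1, by omega⟩ ≤ 0)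
    (hcartan : ∀ k : Fin t,
      ∑ m ∈ Finset.univ.filter (fun m => m ≠ k), R k m / (b k - b m) = 0) :
    b ⟨0, by omega⟩ + ε < 0 ∧ 0 < b ⟨t - 1, by omega⟩ + ε := by
  have hR : ∀ k l, R k l = (b k + ε) * (b l + ε) + (2 * d - ε ^ 2) := by
    intro k l
    rw [hRdef, ha, ha]
    ring
  constructor
  · refine neg_of_cartan_of_extreme_nonpos (x := fun m => b m + ε) (c := 2 * d - ε ^ 2)
      (j := ⟨1, by omega⟩) (l := ⟨t - 1, by omega⟩) ?_ ?_ ?_ ?_ ?_ ?_ ?_ ?_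
    · simp
    · simp only [ne_eq, Fin.mk.injEq]; omega
    · simp only [ne_eq, Fin.mk.injEq]; omega
    · intro m hm
      simp only [ne_eq, Fin.ext_iff] at hm
      exact add_lt_add_left (hb (Fin.lt_def.2 (by dsimp only; omega))) ε
    · intro m hm hm'
      simp only [ne_eq, Fin.ext_iff] at hm hm'
      exact add_lt_add_left (hb (Fin.lt_def.2 (by dsimp only; omega))) ε
    · intro m
      exact add_le_add_left (hb.monotone (Fin.le_def.2 (by dsimp only; omega))) ε
    · rw [← hR]; exact hext
    · intro k
      rw [← hcartan k]
      refine Finset.sum_congr rfl fun m _ => ?_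
      rw [hR, add_sub_add_right_eq_sub]
  · refine neg_neg_iff_pos.1 (neg_of_cartan_of_extreme_nonpos (x := fun m => -(b m + ε))
      (c := 2 * d - ε ^ 2) (i := ⟨t - 1, by omega⟩) (j := ⟨t - 2, by omega⟩) (l := ⟨0, by omega⟩)
      ?_ ?_ ?_ ?_ ?_ ?_ ?_ ?_)
    · simp only [ne_eq, Fin.mk.injEq]; omega
    · simp only [ne_eq, Fin.mk.injEq]; omega
    · simp only [ne_eq, Fin.mk.injEq]; omega
    · intro m hm
      simp only [ne_eq, Fin.ext_iff] at hm
      exact neg_lt_neg (add_lt_add_left (hb (Fin.lt_def.2 (by dsimp only; omega))) ε)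
    · intro m hm hm'
      simp only [ne_eq, Fin.ext_iff] at hm hm'
      exact neg_lt_neg (add_lt_add_left (hb (Fin.lt_def.2 (by dsimp only; omega))) ε)
    · intro m
      exact neg_le_neg (add_le_add_left (hb.monotone (Fin.le_def.2 (by dsimp only; omega))) ε)
    · rw [neg_mul_neg, mul_comm, ← hR]; exact hext
    · intro k
      rw [← neg_eq_zero, ← hcartan k, ← Finset.sum_neg_distrib]
      refine Finset.sum_congr rfl fun m _ => ?_
      rw [hR, ← div_neg, neg_mul_neg]
      congr 1
      ring
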